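/- arXiv:hep-th/9507123 — 2 statements merged into one kernel-verified Lean document; each statement's English description precedes it below -/
import Mathlib

section
/- The three-term identity σ_λ(z)·σ_μ(w) − σ_{λ+μ}(w)·σ_λ(z−w) − σ_μ(w−z)·σ_{λ+μ}(z) = 0 holds. -/
open Complex

/-- Jacobi theta function `θ₁(z,τ) = Σ_{n∈ℤ+1/2} exp(iπn²τ + 2πin(z+1/2))`. -/
noncomputable def theta1 (z τ : ℂ) : ℂ :=
  ∑' n : ℤ, Complex.exp (Real.pi * I * ((n : ℂ) + 1/2)^2 * τ +
    2 * Real.pi * I * ((n : ℂ) + 1/2) * (z + 1/2))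

/-- `θ₁′(0,τ)`, the derivative of `θ₁` in the first variable at `0`. -/
noncomputable def theta1'0 (τ : ℂ) : ℂ := deriv (fun w => theta1 w τ) 0

/-- The function `σ_μ(z) = θ₁(z−μ,τ)θ₁′(0,τ)/(θ₁(z,τ)θ₁(−μ,τ))`. -/
noncomputable def sigmaE (τ μ z : ℂ) : ℂ :=
  theta1 (z - μ) τ * theta1'0 τ / (theta1 z τ * theta1 (-μ) τ)

/-- The lattice `ℤ + τℤ`. -/
def lattice (τ : ℂ) : Set ℂ := {w | ∃ m n : ℤ, w = (m : ℂ) + (n : ℂ) * τ}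

theorem exp_theta1_term_eq (n : ℤ) (z τ : ℂ) :
    cexp (Real.pi * I * ((n : ℂ) + 1/2)^2 * τ + 2 * Real.pi * I * ((n : ℂ) + 1/2) * (z + 1/2)) =
      cexp (Real.pi * I * (τ / 4 + z + 1/2)) * jacobiTheta₂_term n (z + 1/2 + τ / 2) τ := by
  rw [jacobiTheta₂_term, ← Complex.exp_add]
  ring_nf

theorem theta1_eq_jacobiTheta₂ (z τ : ℂ) :
    theta1 z τ =
      cexp (Real.pi * I * (τ / 4 + z + 1/2)) * jacobiTheta₂ (z + 1/2 + τ / 2) τ := by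
  simp_rw [theta1, exp_theta1_term_eq, tsum_mul_left, jacobiTheta₂]

theorem hasSum_theta1 (z : ℂ) {τ : ℂ} (hτ : 0 < τ.im) :
    HasSum (fun n : ℤ => cexp (Real.pi * I * ((n : ℂ) + 1/2)^2 * τ +
      2 * Real.pi * I * ((n : ℂ) + 1/2) * (z + 1/2))) (theta1 z τ) := by
  simp_rw [theta1_eq_jacobiTheta₂, exp_theta1_term_eq]
  exact (hasSum_jacobiTheta₂_term _ hτ).mul_left _

theorem differentiable_theta1 {τ : ℂ} (hτ : 0 < τ.im) :
    Differentiable ℂ (fun z => theta1 z τ) := by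
  intro z
  simp_rw [theta1_eq_jacobiTheta₂]
  refine DifferentiableAt.mul (by fun_prop) ?_
  exact DifferentiableAt.comp (f := fun z : ℂ => z + 1/2 + τ / 2) z
    (differentiableAt_jacobiTheta₂_fst _ hτ) (by fun_prop)

theorem theta1_add_one (z τ : ℂ) : theta1 (z + 1) τ = -theta1 z τ := by
  rw [theta1_eq_jacobiTheta₂, theta1_eq_jacobiTheta₂,
    show z + 1 + 1/2 + τ / 2 = z + 1/2 + τ / 2 + 1 by ring, jacobiTheta₂_add_left,
    show (Real.pi : ℂ) * I * (τ / 4 + (z + 1) + 1/2)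
      = Real.pi * I * (τ / 4 + z + 1/2) + Real.pi * I by ring, Complex.exp_add, exp_pi_mul_I]
  ring

theorem theta1_add_tau (z τ : ℂ) :
    theta1 (z + τ) τ = -cexp (-Real.pi * I * (τ + 2 * z)) * theta1 z τ := by
  rw [theta1_eq_jacobiTheta₂, theta1_eq_jacobiTheta₂,
    show z + τ + 1/2 + τ / 2 = z + 1/2 + τ / 2 + τ by ring, jacobiTheta₂_add_left',
    ← mul_assoc, ← mul_assoc, neg_mul (cexp _), ← Complex.exp_add, ← Complex.exp_add,
    show Real.pi * I * (τ / 4 + (z + τ) + 1/2) + -Real.pi * I * (τ + 2 * (z + 1/2 + τ / 2))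
      = -Real.pi * I * (τ + 2 * z) + Real.pi * I * (τ / 4 + z + 1/2) - Real.pi * I by ring,
    Complex.exp_sub _ (Real.pi * I), exp_pi_mul_I]
  ring

theorem theta1_neg (z τ : ℂ) : theta1 (-z) τ = -theta1 z τ := by
  have h : z + 1/2 + τ / 2 = -(-z + 1/2 + τ / 2) + 1 + τ := by ring
  rw [theta1_eq_jacobiTheta₂, theta1_eq_jacobiTheta₂, h, jacobiTheta₂_add_left',
    jacobiTheta₂_add_left, jacobiTheta₂_neg_left, ← mul_assoc, ← Complex.exp_add,
    show Real.pi * I * (τ / 4 + z + 1/2) + -Real.pi * I * (τ + 2 * (-(-z + 1/2 + τ / 2) + 1))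
      = Real.pi * I * (τ / 4 + -z + 1/2) - Real.pi * I by ring,
    Complex.exp_sub _ (Real.pi * I), exp_pi_mul_I]
  ring

/-- The even-frequency function `Σ_k exp(2πiτk² + 4πikx)`. -/
noncomputable def thetaEven (τ x : ℂ) : ℂ := jacobiTheta₂ (2 * x) (2 * τ)

/-- The odd-frequency function `Σ_k exp(πiτ(2k+1)²/2 + 2πi(2k+1)x)`. -/
noncomputable def thetaOdd (τ x : ℂ) : ℂ :=
  cexp (Real.pi * I * τ / 2 + 2 * Real.pi * I * x) * jacobiTheta₂ (2 * x + τ) (2 * τ)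

theorem hasSum_thetaEven (x : ℂ) {τ : ℂ} (hτ : 0 < τ.im) :
    HasSum (fun k : ℤ => cexp (2 * Real.pi * I * k ^ 2 * τ + 4 * Real.pi * I * k * x))
      (thetaEven τ x) := by
  refine (hasSum_jacobiTheta₂_term (2 * x) (τ := 2 * τ)
    (by simpa using hτ)).congr_fun fun k => ?_
  rw [jacobiTheta₂_term]
  ring_nf

theorem hasSum_thetaOdd (x : ℂ) {τ : ℂ} (hτ : 0 < τ.im) :
    HasSum (fun k : ℤ => cexp (Real.pi * I * (2 * k + 1) ^ 2 * τ / 2 +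
      2 * Real.pi * I * (2 * k + 1) * x)) (thetaOdd τ x) := by
  have h := (hasSum_jacobiTheta₂_term (2 * x + τ) (τ := 2 * τ) (by simpa using hτ)).mul_left
    (cexp (Real.pi * I * τ / 2 + 2 * Real.pi * I * x))
  refine h.congr_fun fun k => ?_
  rw [jacobiTheta₂_term, ← Complex.exp_add]
  ring_nf

theorem HasSum.mul_prod_complex {f g : ℤ → ℂ} {a b : ℂ} (hf : HasSum f a) (hg : HasSum g b) :
    HasSum (fun p : ℤ × ℤ => f p.1 * g p.2) (a * b) :=
  hf.mul hg (summable_mul_of_summable_norm hf.summable.norm hg.summable.norm)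

theorem isCompl_range_parity :
    IsCompl (Set.range fun p : ℤ × ℤ => (p.1 + p.2, p.1 - p.2 - 1))
      (Set.range fun p : ℤ × ℤ => (p.1 + p.2, p.1 - p.2)) := by
  constructor
  · rw [Set.disjoint_left]
    rintro _ ⟨⟨k, l⟩, rfl⟩ ⟨⟨k', l'⟩, h⟩
    simp only [Prod.mk.injEq] at h
    omega
  · rw [codisjoint_iff_le_sup]
    rintro ⟨n, m⟩ -
    rcases Int.even_or_odd' (n + m) with ⟨c, hc | hc⟩
    · exact Or.inr ⟨(c, n - c), by ext <;> simp only <;> omega⟩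
    · exact Or.inl ⟨(c + 1, n - c - 1), by ext <;> simp only <;> omega⟩

theorem HasSum.of_parity {f : ℤ × ℤ → ℂ} {a b : ℂ}
    (ha : HasSum (fun p : ℤ × ℤ => f (p.1 + p.2, p.1 - p.2 - 1)) a)
    (hb : HasSum (fun p : ℤ × ℤ => f (p.1 + p.2, p.1 - p.2)) b) : HasSum f (a + b) := by
  have hi : Function.Injective fun p : ℤ × ℤ => (p.1 + p.2, p.1 - p.2 - 1) := by
    rintro ⟨k, l⟩ ⟨k', l'⟩ h
    simp only [Prod.mk.injEq] at h ⊢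
    omega
  have hj : Function.Injective fun p : ℤ × ℤ => (p.1 + p.2, p.1 - p.2) := by
    rintro ⟨k, l⟩ ⟨k', l'⟩ h
    simp only [Prod.mk.injEq] at h ⊢
    omega
  exact HasSum.add_isCompl isCompl_range_parity ((hi.hasSum_range_iff (f := f)).2 ha)
    ((hj.hasSum_range_iff (f := f)).2 hb)

theorem theta1_add_mul_theta1_sub (x y : ℂ) {τ : ℂ} (hτ : 0 < τ.im) :
    theta1 (x + y) τ * theta1 (x - y) τ =
      thetaEven τ x * thetaOdd τ y - thetaOdd τ x * thetaEven τ y := by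
  have hprod := (hasSum_theta1 (x + y) hτ).mul_prod_complex (hasSum_theta1 (x - y) hτ)
  refine hprod.unique ?_
  rw [sub_eq_add_neg (_ * _)]
  refine HasSum.of_parity
    (((hasSum_thetaEven x hτ).mul_prod_complex (hasSum_thetaOdd y hτ)).congr_fun ?_)
    (((hasSum_thetaOdd x hτ).mul_prod_complex (hasSum_thetaEven y hτ)).neg.congr_fun ?_)
  · rintro ⟨k, l⟩
    simp only [← Complex.exp_add]
    rw [← Complex.exp_periodic.int_mul k (2 * Real.pi * I * (k : ℂ) ^ 2 * τ + _ + _)]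
    push_cast
    ring_nf
  · rintro ⟨k, l⟩
    simp only [← Complex.exp_add]
    rw [← Complex.exp_antiperiodic, ← Complex.exp_periodic.int_mul k (_ + Real.pi * I)]
    push_cast
    ring_nf

theorem theta1_three_term {τ : ℂ} (hτ : 0 < τ.im) (lam μ z w : ℂ) :
    theta1 (z - lam) τ * theta1 (w - μ) τ * theta1 (-(lam + μ)) τ * theta1 (z - w) τ
      - theta1 (w - (lam + μ)) τ * theta1 (z - w - lam) τ * theta1 z τ * theta1 (-μ) τ
      + theta1 (w - z - μ) τ * theta1 (z - (lam + μ)) τ * theta1 w τ * theta1 (-lam) τ = 0 := by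
  set X := (z + w - lam - μ) / 2 with hX
  set Y := (z - w - lam + μ) / 2 with hY
  set U := (z - w - lam - μ) / 2 with hU
  set V := (z - w + lam + μ) / 2 with hV
  rw [show z - lam = X + Y by ring, show w - μ = X - Y by ring,
    show -(lam + μ) = U - V by ring, show z - w = U + V by ring,
    show w - (lam + μ) = X - V by ring, show U + V - lam = Y + U by ring,
    show -μ = -(Y - U) by ring, show w - z - μ = -(Y + V) by ring,
    show z - (lam + μ) = X + U by ring, 
    show theta1 z τ = theta1 (X + V) τ from congrArg (theta1 · τ) (by ring),
    show theta1 w τ = theta1 (X - U) τ from congrArg (theta1 · τ) (by ring), show -lam = Y - V by ring,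
    theta1_neg, theta1_neg]
  have h1 := theta1_add_mul_theta1_sub X Y hτ
  have h2 := theta1_add_mul_theta1_sub U V hτ
  have h3 := theta1_add_mul_theta1_sub X U hτ
  have h4 := theta1_add_mul_theta1_sub Y V hτ
  have h5 := theta1_add_mul_theta1_sub X V hτ
  have h6 := theta1_add_mul_theta1_sub Y U hτ
  calc _ = theta1 (X + Y) τ * theta1 (X - Y) τ * (theta1 (U + V) τ * theta1 (U - V) τ)
      - theta1 (X + U) τ * theta1 (X - U) τ * (theta1 (Y + V) τ * theta1 (Y - V) τ)
      + theta1 (X + V) τ * theta1 (X - V) τ * (theta1 (Y + U) τ * theta1 (Y - U) τ) := by ring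
    _ = 0 := by rw [h1, h2, h3, h4, h5, h6]; ring

theorem exists_jacobiTheta₂_ne_zero {τ : ℂ} (hτ : 0 < τ.im) : ∃ z, jacobiTheta₂ z τ ≠ 0 := by
  by_contra! h
  let f : ℤ → C(ℝ, ℂ) := fun n => ⟨fun x => jacobiTheta₂_term n x τ, by
    unfold jacobiTheta₂_term; fun_prop⟩
  have hsum : Summable fun n => ‖(f n).restrict
      (⟨Set.uIcc (0 : ℝ) 1, isCompact_uIcc⟩ : TopologicalSpace.Compacts ℝ)‖ := by
    refine Summable.of_nonneg_of_le (fun _ => norm_nonneg _) (fun n => ?_)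
      ((summable_jacobiTheta₂_term_iff 0 τ).2 hτ).norm
    refine (ContinuousMap.norm_le _ (norm_nonneg _)).2 fun x => ?_
    simp [f, norm_jacobiTheta₂_term]
  have hint := intervalIntegral.hasSum_intervalIntegral_of_summable_norm hsum
  have hzero : ∀ x : ℝ, ∑' n, f n x = 0 := fun x => h x
  simp only [hzero, intervalIntegral.integral_zero] at hint
  have hcoeff : ∀ n : ℤ, n ≠ 0 → ∫ x in (0 : ℝ)..1, f n x = 0 := by
    intro n hn
    have hc : 2 * Real.pi * I * (n : ℂ) ≠ 0 := by
      simp [Real.pi_ne_zero, hn]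
    simp only [f, ContinuousMap.coe_mk, jacobiTheta₂_term, Complex.exp_add,
      intervalIntegral.integral_mul_const, integral_exp_mul_complex hc]
    rw [show 2 * Real.pi * I * (n : ℂ) * ((1 : ℝ) : ℂ) = n * (2 * Real.pi * I) by push_cast; ring,
      Complex.exp_int_mul_two_pi_mul_I]
    simp
  have := hint.unique (hasSum_single 0 hcoeff)
  simp [f, jacobiTheta₂_term] at this

theorem exists_theta1_ne_zero {τ : ℂ} (hτ : 0 < τ.im) : ∃ z, theta1 z τ ≠ 0 := by
  obtain ⟨z, hz⟩ := exists_jacobiTheta₂_ne_zero hτ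
  refine ⟨z - 1/2 - τ / 2, ?_⟩
  rw [theta1_eq_jacobiTheta₂, show z - 1/2 - τ / 2 + 1/2 + τ / 2 = z by ring]
  exact mul_ne_zero (Complex.exp_ne_zero _) hz

theorem exists_eq_const_mul_exp_mul {g t : ℂ → ℂ} (hg : Differentiable ℂ g)
    (ht : Differentiable ℂ t) {c : ℂ} (hgc : g c ≠ 0) (htc : t c ≠ 0)
    (h : ∀ u v s, g (u + s) * g (v - s) * (t u * t v) = g u * g v * (t (u + s) * t (v - s))) :
    ∃ C k : ℂ, ∀ s, g s = C * cexp (k * s) * t s := by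
  have hwr : ∀ u v, (deriv g u * g v - g u * deriv g v) * (t u * t v)
      = g u * g v * (deriv t u * t v - t u * deriv t v) := by
    intro u v
    have hd : ∀ {f : ℂ → ℂ}, Differentiable ℂ f →
        HasDerivAt (fun s => f (u + s) * f (v - s)) (deriv f u * f v - f u * deriv f v) 0 := by
      intro f hf
      have h1 : HasDerivAt (fun s => f (u + s)) (deriv f u) 0 :=
        HasDerivAt.comp_const_add u 0 (by simpa using (hf u).hasDerivAt)
      have h2 : HasDerivAt (fun s => f (v - s)) (-deriv f v) 0 :=
        HasDerivAt.comp_const_sub v 0 (by simpa using (hf v).hasDerivAt)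
      refine (h1.mul h2).congr_deriv ?_
      simp
      ring
    refine ((hd hg).mul_const (t u * t v)).unique ?_
    simp_rw [h u v]
    exact (hd ht).const_mul (g u * g v)
  set k := deriv g c / g c - deriv t c / t c with hk
  have hode : ∀ s, deriv g s * t s - g s * deriv t s = k * (g s * t s) := by
    intro s
    have := hwr s c
    rw [hk]
    field_simp
    linear_combination this
  set F : ℂ → ℂ := fun s => g s * cexp (-(k * s)) / t s
  have hne : ∀ᶠ s in nhds c, t s ≠ 0 := ht.continuous.continuousAt.eventually_ne htc
  obtain ⟨r, hr, hball⟩ := Metric.eventually_nhds_iff_ball.1 hne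
  have hF : ∀ s ∈ Metric.ball c r, HasDerivAt F 0 s := by
    intro s hs
    have he : HasDerivAt (fun s => cexp (-(k * s))) (cexp (-(k * s)) * -(k * 1)) s :=
      ((hasDerivAt_id s).const_mul k).neg.cexp
    refine (((hg s).hasDerivAt.mul he).div (ht s).hasDerivAt (hball s hs)).congr_deriv ?_
    rw [div_eq_zero_iff]
    left
    simp only [Pi.mul_apply]
    linear_combination cexp (-(k * s)) * hode s
  have hconst : ∀ s ∈ Metric.ball c r, F s = F c := fun s hs =>
    Metric.isOpen_ball.is_const_of_deriv_eq_zero (convex_ball c r).isPreconnected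
      (fun x hx => (hF x hx).differentiableAt.differentiableWithinAt)
      (fun x hx => (hF x hx).deriv) hs (Metric.mem_ball_self hr)
  refine ⟨F c, k, fun s => ?_⟩
  have hR : Differentiable ℂ fun s => F c * cexp (k * s) * t s := by fun_prop
  refine congrFun (AnalyticOnNhd.eq_of_eventuallyEq (𝕜 := ℂ) (z₀ := c)
    (fun x _ => hg.analyticAt x) (fun x _ => hR.analyticAt x) ?_) s
  filter_upwards [Metric.ball_mem_nhds c hr] with s hs
  have hts := hball s hs
  rw [← hconst s hs]
  simp only [F, Complex.exp_neg]
  have := Complex.exp_ne_zero (k * s)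
  field_simp

theorem mem_lattice_of_theta1_eq_zero {τ : ℂ} (hτ : 0 < τ.im) {a : ℂ} (ha : theta1 a τ = 0) :
    a ∈ lattice τ := by
  have hg : Differentiable ℂ fun s => theta1 (s + a) τ :=
    (differentiable_theta1 hτ).comp (differentiable_id.add_const a)
  have ht := differentiable_theta1 hτ
  obtain ⟨c, hgc, htc⟩ : ∃ c, theta1 (c + a) τ ≠ 0 ∧ theta1 c τ ≠ 0 := by
    by_contra! hc
    obtain ⟨z, hz⟩ := exists_theta1_ne_zero hτ
    have hev : ∀ᶠ s in nhds (z - a), theta1 (s + a) τ ≠ 0 :=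
      hg.continuous.continuousAt.eventually_ne (by simpa using hz)
    refine hz (congrFun (AnalyticOnNhd.eq_of_eventuallyEq (𝕜 := ℂ) (z₀ := z - a) (g := 0)
      (fun x _ => ht.analyticAt x) (fun x _ => analyticAt_const) ?_) z)
    filter_upwards [hev] with s hs
    exact hc s hs
  obtain ⟨C, k, h⟩ := exists_eq_const_mul_exp_mul hg ht hgc htc (fun u v s => by
    have h3 := theta1_three_term hτ (-a) (s - v) (u + s) (u + s - v)
    rw [show u + s - -a = u + s + a by ring, show u + s - v - (s - v) = u by ring,
      show -(-a + (s - v)) = v - s + a by ring, show u + s - (u + s - v) = v by ring,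
      show u + s - v - (-a + (s - v)) = u + a by ring, sub_neg_eq_add v a, neg_neg, neg_sub,
      ha] at h3
    linear_combination h3)
  have h0 : C * cexp (k * c) * theta1 c τ ≠ 0 := by rwa [← h c]
  have hone : cexp k = 1 := by
    have h1 := h (c + 1)
    rw [add_right_comm, theta1_add_one, theta1_add_one, h c, mul_add, mul_one,
      Complex.exp_add] at h1
    refine mul_left_cancel₀ h0 ?_
    linear_combination h1
  have htau : cexp (k * τ) = cexp (-(2 * Real.pi * I * a)) := by
    have h1 := h (c + τ)
    rw [add_right_comm, theta1_add_tau, theta1_add_tau, h c, mul_add k,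
      Complex.exp_add (k * c),
      show -(Real.pi : ℂ) * I * (τ + 2 * (c + a))
        = -Real.pi * I * (τ + 2 * c) + -(2 * Real.pi * I * a) by ring,
      Complex.exp_add (-Real.pi * I * (τ + 2 * c))] at h1
    refine mul_left_cancel₀ (mul_ne_zero (Complex.exp_ne_zero (-Real.pi * I * (τ + 2 * c))) h0) ?_
    linear_combination h1
  obtain ⟨n, hn⟩ := Complex.exp_eq_one_iff.1 hone
  obtain ⟨m, hm⟩ := Complex.exp_eq_exp_iff_exists_int.1 htau
  refine ⟨m, -n, ?_⟩
  refine mul_left_cancel₀ Complex.two_pi_I_ne_zero ?_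
  push_cast
  rw [hn] at hm
  linear_combination hm

/-- the three-term identity
σ_λ(z)σ_μ(w) − σ_{λ+μ}(w)σ_λ(z−w) − σ_μ(w−z)σ_{λ+μ}(z) = 0. -/
theorem sigma_three_term (τ : ℂ) (hτ : 0 < τ.im) (lam μ z w : ℂ)
    (hlam : lam ∉ lattice τ) (hμ : μ ∉ lattice τ) (hlamμ : lam + μ ∉ lattice τ)
    (hz : z ∉ lattice τ) (hw : w ∉ lattice τ)
    (hzw : z - w ∉ lattice τ) (hwz : w - z ∉ lattice τ) :
    sigmaE τ lam z * sigmaE τ μ w - sigmaE τ (lam + μ) w * sigmaE τ lam (z - w)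
      - sigmaE τ μ (w - z) * sigmaE τ (lam + μ) z = 0 := by
  have hne : ∀ a, a ∉ lattice τ → theta1 a τ ≠ 0 := fun a ha h =>
    ha (mem_lattice_of_theta1_eq_zero hτ h)
  have h1 := hne _ hlam
  have h2 := hne _ hμ
  have h3 := hne _ hlamμ
  have h4 := hne _ hz
  have h5 := hne _ hw
  have h6 := hne _ hzw
  have key := theta1_three_term hτ lam μ z w
  simp only [theta1_neg] at key
  simp only [sigmaE, theta1_neg, show theta1 (w - z) τ = -theta1 (z - w) τ by
    rw [← theta1_neg, neg_sub]]
  field_simp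
  linear_combination -theta1'0 τ ^ 2 * key
end

section
/- The rational boundary K-operator K(ξ)f(z) = (1/z − 1/(2ξ))·f(z) − (1/z − 1/(2ν))·f(−z) together with the rational R-operator satisfies the boundary Yang–Baxter equation R₂₁(ξ₁−ξ₂)(K(ξ₁)⊗1)R₁₂(ξ₁+ξ₂)(1⊗K(ξ₂)) = (1⊗K(ξ₂))R₂₁(ξ₁+ξ₂)(K(ξ₁)⊗1)R₁₂(ξ₁−ξ₂). -/
open Complex

/-- Rational R-operator R₁₂(ξ) on functions of two variables. -/
noncomputable def ratR12 (μ ξ : ℂ) (f : ℂ → ℂ → ℂ) : ℂ → ℂ → ℂ :=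
  fun z1 z2 => (1 / (z1 - z2) - 1 / μ) * f z1 z2 - (1 / (z1 - z2) - 1 / ξ) * f z2 z1

/-- Rational R-operator R₂₁(ξ) on functions of two variables. -/
noncomputable def ratR21 (μ ξ : ℂ) (f : ℂ → ℂ → ℂ) : ℂ → ℂ → ℂ :=
  fun z1 z2 => (1 / (z2 - z1) - 1 / μ) * f z1 z2 - (1 / (z2 - z1) - 1 / ξ) * f z2 z1

/-- Rational boundary K-operator acting on the first variable: K(ξ)⊗1. -/
noncomputable def ratK1 (ν ξ : ℂ) (f : ℂ → ℂ → ℂ) : ℂ → ℂ → ℂ :=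
  fun z1 z2 => (1 / z1 - 1 / (2 * ξ)) * f z1 z2 - (1 / z1 - 1 / (2 * ν)) * f (-z1) z2

/-- Rational boundary K-operator acting on the second variable: 1⊗K(ξ). -/
noncomputable def ratK2 (ν ξ : ℂ) (f : ℂ → ℂ → ℂ) : ℂ → ℂ → ℂ :=
  fun z1 z2 => (1 / z2 - 1 / (2 * ξ)) * f z1 z2 - (1 / z2 - 1 / (2 * ν)) * f z1 (-z2)

/-- the rational boundary K-operator satisfies the boundary Yang–Baxter
equation with the rational R-operator, pointwise where all denominators are nonzero. -/
theorem rational_boundary_YBE (μ ν ξ1 ξ2 : ℂ) (hμ : μ ≠ 0) (hν : ν ≠ 0)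
    (hξ1 : ξ1 ≠ 0) (hξ2 : ξ2 ≠ 0) (hsum : ξ1 + ξ2 ≠ 0) (hdiff : ξ1 - ξ2 ≠ 0)
    (f : ℂ → ℂ → ℂ) (z1 z2 : ℂ) (hz1 : z1 ≠ 0) (hz2 : z2 ≠ 0)
    (hz12 : z1 ≠ z2) (hz12' : z1 + z2 ≠ 0) :
    ratR21 μ (ξ1 - ξ2) (ratK1 ν ξ1 (ratR12 μ (ξ1 + ξ2) (ratK2 ν ξ2 f))) z1 z2 =
    ratK2 ν ξ2 (ratR21 μ (ξ1 + ξ2) (ratK1 ν ξ1 (ratR12 μ (ξ1 - ξ2) f))) z1 z2 := by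
  have h12 : z1 - z2 ≠ 0 := sub_ne_zero.mpr hz12
  simp only [ratR21, ratR12, ratK1, ratK2, neg_neg, sub_neg_eq_add]
  generalize f z1 z2 = a, f z1 (-z2) = b, f (-z1) z2 = c, f (-z1) (-z2) = d,
    f z2 z1 = e, f z2 (-z1) = g, f (-z2) z1 = h, f (-z2) (-z1) = k
  have e21 : 1 / (z2 - z1) = -(1 / (z1 - z2)) := by rw [← neg_sub z1 z2, div_neg]
  have e1 : 1 / (-z1 - z2) = -(1 / (z1 + z2)) := by rw [← neg_add', div_neg]
  have e2 : 1 / (-z2 - z1) = -(1 / (z1 + z2)) := by rw [← neg_add', div_neg, add_comm]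
  have e3 : -z1 + z2 = -(z1 - z2) := by ring
  simp only [e21, e1, e2, e3, div_neg]
  field_simp
  ring
end
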